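/- arXiv:2311.16340 — 2 statements merged into one kernel-verified Lean document; each statement's English description precedes it below -/
import Mathlib

section
/- Let (X, ν, 𝒯₁, τ₁) be a Type 1 computable topological space (actual inclusion as formal inclusion), let (Y, μ) be a subnumbered set equipped with a Lacombe basis (ℬ₂, β₂) generating the Lacombe topology (𝒯₂, τ₂), and let f : X → Y be a (ν,μ)-computable function. Then f is effectively continuous (from (X,ν,𝒯₁,τ₁) to (Y,μ,𝒯₂,τ₂)) if and only if the preimage map B ↦ f⁻¹(B) from ℬ₂ to 𝒯₁ is (β₂,τ₁)-computable, i.e. some partial computable function turns every β₂-name of a basic set B into a τ₁-name of f⁻¹(B). -/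
namespace T1

/-- `phi e` : the `e`-th partial computable function `ℕ ⇀ ℕ`. -/
def phi (e : ℕ) : ℕ →. ℕ :=
  Nat.Partrec.Code.eval (Denumerable.ofNat Nat.Partrec.Code e)

/-- `W e` : the `e`-th computably enumerable subset of `ℕ`. -/
def W (e : ℕ) : Set ℕ := (phi e).Dom

/-- A canonical numbering of the rationals. -/
def ratOfNat (k : ℕ) : ℚ := (Encodable.decode (α := ℚ) k).getD 0

/-- `e` is a name of `A ⊆ X` as a `ν`-semi-decidable set (a `ν_SD,m`-name):
`phi e` halts on a `ν`-name exactly when the named point belongs to `A`. -/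
def SemiDecName {X : Type*} (ν : ℕ →. X) (A : Set X) (e : ℕ) : Prop :=
  ∀ i x, x ∈ ν i → ((phi e i).Dom ↔ x ∈ A)

/-- `f : X → Y` is `(ν,μ)`-computable. -/
def Computes {X Y : Type*} (ν : ℕ →. X) (μ : ℕ →. Y) (f : X → Y) : Prop :=
  ∃ F : ℕ →. ℕ, Nat.Partrec F ∧ ∀ n x, x ∈ ν n → ∃ m ∈ F n, f x ∈ μ m

/-- `r` is a formal inclusion relation for the naming relation `β` of a family of
subsets of `X`: reflexive (on names), transitive, and implying actual inclusion. -/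
structure IsFormalIncl {X : Type*} (β : ℕ → Set X → Prop) (r : ℕ → ℕ → Prop) : Prop where
  refl : ∀ n A, β n A → r n n
  trans : ∀ a b c, r a b → r b c → r a c
  mono : ∀ n m A B, r n m → β n A → β m B → A ⊆ B

/-- Extension of a formal inclusion relation: a name vs. a sequence of names. -/
def SeqIncl (r : ℕ → ℕ → Prop) (b : ℕ) (s : ℕ → ℕ) : Prop := ∃ k, r b (s k)

/-- Extension of a formal inclusion relation: sequence vs. sequence. -/
def SeqIncl₂ (r : ℕ → ℕ → Prop) (s t : ℕ → ℕ) : Prop := ∀ p, SeqIncl r (s p) t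

/-- The equivalence induced by the extended formal inclusion on sequences. -/
def SeqEquiv (r : ℕ → ℕ → Prop) (s t : ℕ → ℕ) : Prop := SeqIncl₂ r s t ∧ SeqIncl₂ r t s

/-- A Type 1 computable topological space `(X, ν, T, τ, r)`, where `τ` is a
(single-valued) naming relation for open sets and `r` a formal inclusion relation. -/
structure IsCTS {X : Type*} (ν : ℕ →. X) (T : TopologicalSpace X)
    (τ : ℕ → Set X → Prop) (r : ℕ → ℕ → Prop) : Prop where
  single : ∀ n A B, τ n A → τ n B → A = B
  formal : IsFormalIncl τ r
  isOpen : ∀ n A, τ n A → T.IsOpen A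
  generates : T = TopologicalSpace.generateFrom {A | ∃ n, τ n A}
  empty : ∃ n, τ n (∅ : Set X)
  univ : ∃ n, τ n (Set.univ : Set X)
  malcev : ∃ F : ℕ →. ℕ, Nat.Partrec F ∧ ∀ n A, τ n A → ∃ e ∈ F n, SemiDecName ν A e
  union : ∃ U : ℕ →. ℕ, Nat.Partrec U ∧
    (∀ c (s : ℕ → ℕ) (A : ℕ → Set X), (∀ k, s k ∈ phi c k) → (∀ k, τ (s k) (A k)) →
      ∃ u ∈ U c, τ u (⋃ k, A k) ∧ ∀ k, r (s k) u) ∧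
    (∀ c (s : ℕ → ℕ) (A : ℕ → Set X) c' (s' : ℕ → ℕ) (A' : ℕ → Set X),
      (∀ k, s k ∈ phi c k) → (∀ k, τ (s k) (A k)) →
      (∀ k, s' k ∈ phi c' k) → (∀ k, τ (s' k) (A' k)) →
      (∀ p, SeqIncl r (s p) s') →
      ∀ u ∈ U c, ∀ u' ∈ U c', r u u')
  inter : ∃ I : ℕ →. ℕ, Nat.Partrec I ∧
    (∀ n₁ n₂ A₁ A₂, τ n₁ A₁ → τ n₂ A₂ → ∃ u ∈ I (Nat.pair n₁ n₂), τ u (A₁ ∩ A₂)) ∧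
    (∀ n₁ n₂ A₁ A₂ n₁' n₂' A₁' A₂', τ n₁ A₁ → τ n₂ A₂ → τ n₁' A₁' → τ n₂' A₂' →
      r n₁ n₁' → r n₂ n₂' →
      ∀ u ∈ I (Nat.pair n₁ n₂), ∀ u' ∈ I (Nat.pair n₁' n₂'), r u u')

/-- A Type 1 computable topological space with the actual inclusion relation as
formal inclusion (all monotonicity requirements are then automatic and omitted). -/
structure IsCTSIncl {X : Type*} (ν : ℕ →. X) (T : TopologicalSpace X)
    (τ : ℕ → Set X → Prop) : Prop where
  single : ∀ n A B, τ n A → τ n B → A = B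
  isOpen : ∀ n A, τ n A → T.IsOpen A
  generates : T = TopologicalSpace.generateFrom {A | ∃ n, τ n A}
  empty : ∃ n, τ n (∅ : Set X)
  univ : ∃ n, τ n (Set.univ : Set X)
  malcev : ∃ F : ℕ →. ℕ, Nat.Partrec F ∧ ∀ n A, τ n A → ∃ e ∈ F n, SemiDecName ν A e
  union : ∃ U : ℕ →. ℕ, Nat.Partrec U ∧
    ∀ c (s : ℕ → ℕ) (A : ℕ → Set X), (∀ k, s k ∈ phi c k) → (∀ k, τ (s k) (A k)) →
      ∃ u ∈ U c, τ u (⋃ k, A k)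
  inter : ∃ I : ℕ →. ℕ, Nat.Partrec I ∧
    ∀ n₁ n₂ A₁ A₂, τ n₁ A₁ → τ n₂ A₂ → ∃ u ∈ I (Nat.pair n₁ n₂), τ u (A₁ ∩ A₂)

/-- A Nogina basis for `(X, ν)` (with `ν` intended to be a numbering, i.e. onto). -/
structure IsNoginaBasis {X : Type*} (ν : ℕ →. X) (β : ℕ → Set X → Prop) : Prop where
  single : ∀ b B B', β b B → β b B' → B = B'
  semidec : ∃ F : ℕ →. ℕ, Nat.Partrec F ∧ ∀ b B, β b B → ∃ e ∈ F b, SemiDecName ν B e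
  point : ∃ G : ℕ →. ℕ, Nat.Partrec G ∧
    ∀ n x, x ∈ ν n → ∃ b ∈ G n, ∃ B, β b B ∧ x ∈ B
  inter : ∃ H : ℕ →. ℕ, Nat.Partrec H ∧
    ∀ b₁ b₂ B₁ B₂ n x, β b₁ B₁ → β b₂ B₂ → x ∈ ν n → x ∈ B₁ → x ∈ B₂ →
      ∃ b₃ ∈ H (Nat.pair (Nat.pair b₁ b₂) n), ∃ B₃, β b₃ B₃ ∧ x ∈ B₃ ∧ B₃ ⊆ B₁ ∩ B₂

/-- `p = ⟨e₁, e₂⟩` is a name of the open set `O` for the Nogina topology of the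
basis `β`: `e₁` witnesses semi-decidability of `O` and `e₂` computes, from a
`ν`-name of a point of `O`, a basic set containing the point and contained in `O`. -/
def NoginaName {X : Type*} (ν : ℕ →. X) (β : ℕ → Set X → Prop) (p : ℕ) (O : Set X) : Prop :=
  SemiDecName ν O p.unpair.1 ∧
  ∀ n x, x ∈ ν n → x ∈ O → ∃ b ∈ phi p.unpair.2 n, ∃ B, β b B ∧ x ∈ B ∧ B ⊆ O

/-- `i` is a name of `O` as a Lacombe set: `W i ⊆ dom β` and `O` is the union of
the basic sets named by elements of `W i`. -/
def LacombeName {X : Type*} (β : ℕ → Set X → Prop) (i : ℕ) (O : Set X) : Prop :=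
  (∀ k ∈ W i, ∃ B, β k B) ∧ O = ⋃ k ∈ W i, ⋃ B, ⋃ (_ : β k B), B

/-- A Lacombe basis for `(X, ν)`. -/
structure IsLacombeBasis {X : Type*} (ν : ℕ →. X) (β : ℕ → Set X → Prop) : Prop where
  single : ∀ b B B', β b B → β b B' → B = B'
  semidec : ∃ F : ℕ →. ℕ, Nat.Partrec F ∧ ∀ b B, β b B → ∃ e ∈ F b, SemiDecName ν B e
  point : ∀ x : X, ∃ b B, β b B ∧ x ∈ B
  cover : ∃ i, LacombeName β i (Set.univ : Set X)
  inter : ∃ H : ℕ →. ℕ, Nat.Partrec H ∧ ∀ b₁ b₂ B₁ B₂, β b₁ B₁ → β b₂ B₂ →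
    ∃ i ∈ H (Nat.pair b₁ b₂), LacombeName β i (B₁ ∩ B₂)

/-- A Spreen basis for `(X, ν)`, with formal inclusion relation `r`.  Computable
functions with values in `dom(β)^ℕ` are represented by partial computable
functions producing the `k`-th term of the sequence from the pair `⟨input, k⟩`. -/
structure IsSpreenBasis {X : Type*} (ν : ℕ →. X) (β : ℕ → Set X → Prop)
    (r : ℕ → ℕ → Prop) : Prop where
  single : ∀ b B B', β b B → β b B' → B = B'
  formal : IsFormalIncl β r
  semidec : ∃ F : ℕ →. ℕ, Nat.Partrec F ∧ ∀ b B, β b B → ∃ e ∈ F b, SemiDecName ν B e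
  dense : ∀ b B, β b B → B.Nonempty → ∃ n x, x ∈ ν n ∧ x ∈ B
  G1 : ∃ g : ℕ →. ℕ, Nat.Partrec g ∧
    (∀ n x, x ∈ ν n → ∃ s : ℕ → ℕ, (∀ k, s k ∈ g (Nat.pair n k)) ∧
      ∀ k, ∃ B, β (s k) B ∧ x ∈ B) ∧
    (∀ n m x (s t : ℕ → ℕ), x ∈ ν n → x ∈ ν m →
      (∀ k, s k ∈ g (Nat.pair n k)) → (∀ k, t k ∈ g (Nat.pair m k)) → SeqEquiv r s t) ∧
    (∀ x : X, ∃ b B, β b B ∧ x ∈ B ∧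
      ∀ n y, y ∈ ν n → y ∈ B → ∀ s : ℕ → ℕ, (∀ k, s k ∈ g (Nat.pair n k)) → SeqIncl r b s)
  G2 : ∃ g : ℕ →. ℕ, Nat.Partrec g ∧
    (∀ n x b₁ b₂ B₁ B₂, x ∈ ν n → β b₁ B₁ → β b₂ B₂ → x ∈ B₁ → x ∈ B₂ →
      ∃ s : ℕ → ℕ, (∀ k, s k ∈ g (Nat.pair (Nat.pair n (Nat.pair b₁ b₂)) k)) ∧
        ∀ k, ∃ B, β (s k) B ∧ x ∈ B ∧ B ⊆ B₁ ∩ B₂) ∧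
    (∀ n m x b₁ b₂ b₁' b₂' (s t : ℕ → ℕ), x ∈ ν n → x ∈ ν m → r b₁ b₁' → r b₂ b₂' →
      (∀ k, s k ∈ g (Nat.pair (Nat.pair n (Nat.pair b₁ b₂)) k)) →
      (∀ k, t k ∈ g (Nat.pair (Nat.pair m (Nat.pair b₁' b₂')) k)) → SeqIncl₂ r s t) ∧
    (∀ b₁ b₂ B₁ B₂, β b₁ B₁ → β b₂ B₂ → ∀ x, x ∈ B₁ → x ∈ B₂ →
      ∃ b₃ B₃, β b₃ B₃ ∧ x ∈ B₃ ∧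
        ∀ m y, y ∈ ν m → y ∈ B₃ → ∀ s : ℕ → ℕ,
          (∀ k, s k ∈ g (Nat.pair (Nat.pair m (Nat.pair b₁ b₂)) k)) → SeqIncl r b₃ s)

/-- `p = ⟨n, m⟩` is a name of the open set `O` for the Spreen topology of the
Spreen basis `(β, r)`. -/
def SpreenName {X : Type*} (ν : ℕ →. X) (β : ℕ → Set X → Prop) (r : ℕ → ℕ → Prop)
    (p : ℕ) (O : Set X) : Prop :=
  SemiDecName ν O p.unpair.1 ∧
  (∀ n x, x ∈ ν n → x ∈ O → ∃ s : ℕ → ℕ,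
      (∀ k, s k ∈ phi p.unpair.2 (Nat.pair n k)) ∧
      ∀ k, ∃ B, β (s k) B ∧ x ∈ B ∧ B ⊆ O) ∧
  (∀ n m x (s t : ℕ → ℕ), x ∈ ν n → x ∈ ν m → x ∈ O →
      (∀ k, s k ∈ phi p.unpair.2 (Nat.pair n k)) →
      (∀ k, t k ∈ phi p.unpair.2 (Nat.pair m k)) → SeqEquiv r s t) ∧
  (∀ x, x ∈ O → ∃ b B, β b B ∧ x ∈ B ∧
      ∀ n y, y ∈ ν n → y ∈ B → ∀ s : ℕ → ℕ,
        (∀ k, s k ∈ phi p.unpair.2 (Nat.pair n k)) → SeqIncl r b s)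

/-- The extension of the formal inclusion relation `r` to names of Spreen open sets. -/
def SpreenTauIncl {X : Type*} (ν : ℕ →. X) (r : ℕ → ℕ → Prop) (p q : ℕ) : Prop :=
  ∀ n ∈ ν.Dom, (phi p.unpair.1 n).Dom →
    (phi q.unpair.1 n).Dom ∧
    ∀ s t : ℕ → ℕ, (∀ k, s k ∈ phi p.unpair.2 (Nat.pair n k)) →
      (∀ k, t k ∈ phi q.unpair.2 (Nat.pair n k)) → SeqIncl₂ r s t

/-- A partial computable translation of Spreen names of open sets for the basis
`(β₁, r₁)` into Spreen names for the basis `(β₂, r₂)`, increasing with respect to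
the extended formal inclusion relations. -/
def SpreenTopTrans {X : Type*} (ν : ℕ →. X) (β₁ : ℕ → Set X → Prop) (r₁ : ℕ → ℕ → Prop)
    (β₂ : ℕ → Set X → Prop) (r₂ : ℕ → ℕ → Prop) : Prop :=
  ∃ h : ℕ →. ℕ, Nat.Partrec h ∧
    (∀ p O, SpreenName ν β₁ r₁ p O → ∃ q ∈ h p, SpreenName ν β₂ r₂ q O) ∧
    (∀ p p' O O', SpreenName ν β₁ r₁ p O → SpreenName ν β₁ r₁ p' O' →
      SpreenTauIncl ν r₁ p p' → ∀ q ∈ h p, ∀ q' ∈ h p', SpreenTauIncl ν r₂ q q')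

/-- Effective continuity between computable topological spaces, with the actual
inclusion relations as formal inclusions. -/
def EffContinuous {X Y : Type*} (T₁ : TopologicalSpace X) (T₂ : TopologicalSpace Y)
    (τ₁ : ℕ → Set X → Prop) (τ₂ : ℕ → Set Y → Prop) (f : X → Y) : Prop :=
  (@Continuous X Y T₁ T₂ f) ∧
  ∃ h : ℕ →. ℕ, Nat.Partrec h ∧ ∀ n O, τ₂ n O → ∃ m ∈ h n, τ₁ m (f ⁻¹' O)

/-- Effective continuity between computable topological spaces with formal
inclusion relations `r₁`, `r₂` on names of open sets. -/
def EffContinuousF {X Y : Type*} (T₁ : TopologicalSpace X) (T₂ : TopologicalSpace Y)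
    (τ₁ : ℕ → Set X → Prop) (τ₂ : ℕ → Set Y → Prop)
    (r₁ r₂ : ℕ → ℕ → Prop) (f : X → Y) : Prop :=
  (@Continuous X Y T₁ T₂ f) ∧
  ∃ h : ℕ →. ℕ, Nat.Partrec h ∧
    (∀ n O, τ₂ n O → ∃ m ∈ h n, τ₁ m (f ⁻¹' O)) ∧
    (∀ n₁ n₂ O₁ O₂, τ₂ n₁ O₁ → τ₂ n₂ O₂ → r₂ n₁ n₂ →
      ∀ m₁ ∈ h n₁, ∀ m₂ ∈ h n₂, r₁ m₁ m₂)

/-- `e` is a Cauchy name (`c_ℝ`-name) of the real number `x`. -/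
def CRealName (e : ℕ) (x : ℝ) : Prop :=
  ∀ n : ℕ, ∃ m ∈ phi e n, |((ratOfNat m : ℚ) : ℝ) - x| < (2 : ℝ) ^ (-(n : ℤ))

/-- `e` is a left (lower) name (`c_↗`-name) of the real number `x`: it computes a
nondecreasing sequence of rationals below `x` converging to `x`. -/
def LRealName (e : ℕ) (x : ℝ) : Prop :=
  ∃ s : ℕ → ℕ, (∀ n, s n ∈ phi e n) ∧
    (Monotone fun n => ratOfNat (s n)) ∧
    (∀ n, ((ratOfNat (s n) : ℚ) : ℝ) < x) ∧
    Filter.Tendsto (fun n => ((ratOfNat (s n) : ℚ) : ℝ)) Filter.atTop (nhds x)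

/-- `(X, ν, d)` is a (non-necessarily effectively separable) computable metric
space: the computable points are dense and the metric is `(ν×ν, c_ℝ)`-computable. -/
structure IsCMS {X : Type*} [MetricSpace X] (ν : ℕ →. X) : Prop where
  dense : Dense {x : X | ∃ n, x ∈ ν n}
  dist_comp : ∃ F : ℕ →. ℕ, Nat.Partrec F ∧
    ∀ n m x y, x ∈ ν n → y ∈ ν m → ∃ e ∈ F (Nat.pair n m), CRealName e (dist x y)

/-- The natural numbering of the open balls of a computable metric space, centered
at computable points with computable radii: `⟨n, m⟩` names `B(ν n, c_ℝ m)`. -/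
def ballName {X : Type*} [MetricSpace X] (ν : ℕ →. X) (p : ℕ) (B : Set X) : Prop :=
  ∃ x r, x ∈ ν p.unpair.1 ∧ CRealName p.unpair.2 r ∧ B = Metric.ball x r

/-- The natural formal inclusion relation on names of balls:
`(x, r₁) ⊆̊ (y, r₂)` iff `d(x, y) + r₁ ≤ r₂`. -/
def ballIncl {X : Type*} [MetricSpace X] (ν : ℕ →. X) (p q : ℕ) : Prop :=
  ∃ x y r s, x ∈ ν p.unpair.1 ∧ y ∈ ν q.unpair.1 ∧
    CRealName p.unpair.2 r ∧ CRealName q.unpair.2 s ∧ dist x y + r ≤ s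

/-- `f` is effectively metric continuous: from a name of a point `x` and a name of
`ε > 0` one can compute a name of some `η > 0` witnessing continuity at `x`. -/
def EffMetricContinuous {X Y : Type*} [MetricSpace X] [MetricSpace Y]
    (ν : ℕ →. X) (f : X → Y) : Prop :=
  ∃ H : ℕ →. ℕ, Nat.Partrec H ∧
    ∀ n x e ε, x ∈ ν n → CRealName e ε → (0:ℝ) < ε →
      ∃ m ∈ H (Nat.pair n e), ∃ η : ℝ, CRealName m η ∧ 0 < η ∧
        ∀ y : X, dist x y < η → dist (f x) (f y) < ε

/-- `(X, ν, d)` admits an algorithm of passage to the limit. -/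
def HasLimitAlg {X : Type*} [MetricSpace X] (ν : ℕ →. X) : Prop :=
  ∃ L : ℕ →. ℕ, Nat.Partrec L ∧
    ∀ c (s : ℕ → ℕ) (xs : ℕ → X) (x : X),
      (∀ k, s k ∈ phi c k) → (∀ k, xs k ∈ ν (s k)) →
      (∀ k m, k < m → dist (xs k) (xs m) < (2 : ℝ) ^ (-(k : ℤ))) →
      Filter.Tendsto xs Filter.atTop (nhds x) →
      ∃ p ∈ L c, x ∈ ν p


/-- The `s`-`m`-`n` theorem for the numbering `phi`. -/
theorem exists_computable_phi_eq {g : ℕ × ℕ →. ℕ} (hg : Partrec g) :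
    ∃ s : ℕ → ℕ, Computable s ∧ ∀ i k, phi (s i) k = g (i, k) := by
  obtain ⟨c, hc⟩ := Nat.Partrec.Code.exists_code.1
    (Partrec.nat_iff.1 (hg.comp Primrec.unpair.to_comp))
  refine ⟨fun i => Encodable.encode (c.curry i),
    (Primrec.encode.comp
      (Nat.Partrec.Code.primrec₂_curry.comp (Primrec.const c) Primrec.id)).to_comp, fun i k => ?_⟩
  simp [phi, Nat.Partrec.Code.eval_curry, hc]

/-- Precomposition of a partial computable function with a computable one. -/
theorem partrec_comp_computable {h : ℕ →. ℕ} (hh : Nat.Partrec h) {s : ℕ → ℕ}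
    (hs : Computable s) : Nat.Partrec fun n => h (s n) :=
  Partrec.nat_iff.1 ((Partrec.nat_iff.2 hh).comp hs)

/-- Names of singletons as computably enumerable sets can be computed. -/
theorem exists_computable_W_eq_singleton :
    ∃ s : ℕ → ℕ, Computable s ∧ ∀ b, W (s b) = {b} := by
  have hg : Partrec fun p : ℕ × ℕ =>
      bif decide (p.2 = p.1) then Part.some 0 else (Part.none : Part ℕ) :=
    Partrec.cond (Primrec.eq.decide.comp Primrec.snd Primrec.fst).to_comp
      (Computable.const 0).partrec Partrec.none
  obtain ⟨s, hs, hsg⟩ := exists_computable_phi_eq hg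
  refine ⟨s, hs, fun b => Set.ext fun a => ?_⟩
  change (phi (s b) a).Dom ↔ a = b
  rw [hsg]
  by_cases hab : a = b <;> simp [hab]

/-- Stage-`t` approximation of membership in the set with index `i`. -/
def enumStage (i : ℕ) (a t : ℕ) : Bool :=
  (Nat.Partrec.Code.evaln t (Denumerable.ofNat Nat.Partrec.Code i) a).isSome

theorem mem_W_iff_exists_enumStage {i a : ℕ} : a ∈ W i ↔ ∃ t, enumStage i a t = true := by
  change (phi i a).Dom ↔ _
  simp only [enumStage, Option.isSome_iff_exists, Part.dom_iff_mem, phi,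
    Nat.Partrec.Code.evaln_complete, Option.mem_def]
  exact exists_comm

theorem computable_enumStage :
    Computable fun p : ℕ × ℕ => enumStage p.1 p.2.unpair.1 p.2.unpair.2 := by
  have hu : Primrec fun p : ℕ × ℕ => p.2.unpair := Primrec.unpair.comp Primrec.snd
  exact (Primrec.option_isSome.comp (Nat.Partrec.Code.primrec_evaln.comp
    (((Primrec.snd.comp hu).pair ((Primrec.ofNat Nat.Partrec.Code).comp Primrec.fst)).pair
      (Primrec.fst.comp hu)))).to_comp

theorem lacombeName_of_W_eq_singleton {X : Type*} {β : ℕ → Set X → Prop}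
    (hβ : ∀ b B B', β b B → β b B' → B = B') {i b : ℕ} {B : Set X} (hi : W i = {b})
    (hB : β b B) : LacombeName β i B := by
  refine ⟨?_, ?_⟩
  · rw [hi]
    rintro k rfl
    exact ⟨B, hB⟩
  · ext x
    simp only [hi, Set.mem_iUnion, Set.mem_singleton_iff, exists_prop, exists_eq_left]
    exact ⟨fun hx => ⟨B, hB, hx⟩, fun ⟨B', hB', hx⟩ => hβ _ _ _ hB' hB ▸ hx⟩

/-- In a computable topological space, names of unions of families of open sets indexed by
computably enumerable sets can be computed from a computable naming of the members. -/
theorem IsCTSIncl.exists_partrec_iUnion_W {X : Type*} {ν : ℕ →. X} {T : TopologicalSpace X}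
    {τ : ℕ → Set X → Prop} (hX : IsCTSIncl ν T τ) {h : ℕ →. ℕ} (hh : Nat.Partrec h) :
    ∃ H : ℕ →. ℕ, Nat.Partrec H ∧ ∀ i (A : ℕ → Set X),
      (∀ a ∈ W i, ∃ m ∈ h a, τ m (A a)) → ∃ u ∈ H i, τ u (⋃ a ∈ W i, A a) := by
  obtain ⟨e, he⟩ := hX.empty
  obtain ⟨U, hU, hUnion⟩ := hX.union
  have hg : Partrec fun p : ℕ × ℕ =>
      bif enumStage p.1 p.2.unpair.1 p.2.unpair.2 then h p.2.unpair.1 else Part.some e :=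
    Partrec.cond computable_enumStage
      ((Partrec.nat_iff.2 hh).comp
        (Primrec.fst.comp (Primrec.unpair.comp Primrec.snd)).to_comp)
      (Computable.const e).partrec
  obtain ⟨s, hs, hsg⟩ := exists_computable_phi_eq hg
  refine ⟨fun i => U (s i), partrec_comp_computable hU hs, fun i A hA => ?_⟩
  let D : ℕ → Set X := fun k =>
    bif enumStage i k.unpair.1 k.unpair.2 then A k.unpair.1 else ∅
  have hname : ∀ k, ∃ m ∈ phi (s i) k, τ m (D k) := fun k => by
    rw [hsg]
    cases hk : enumStage i k.unpair.1 k.unpair.2 with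
    | true => simpa [D, hk] using hA _ (mem_W_iff_exists_enumStage.2 ⟨_, hk⟩)
    | false => simpa [D, hk] using he
  choose m hm hτ using hname
  have hD : (⋃ k, D k) = ⋃ a ∈ W i, A a := by
    ext x
    simp only [Set.mem_iUnion, exists_prop]
    constructor
    · rintro ⟨k, hx⟩
      cases hk : enumStage i k.unpair.1 k.unpair.2 with
      | true =>
        exact ⟨_, mem_W_iff_exists_enumStage.2 ⟨_, hk⟩, by simpa [D, hk] using hx⟩
      | false => simp [D, hk] at hx
    · rintro ⟨a, ha, hx⟩
      obtain ⟨t, ht⟩ := mem_W_iff_exists_enumStage.1 ha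
      exact ⟨Nat.pair a t, by simpa [D, ht] using hx⟩
  exact hD ▸ hUnion (s i) m D hm hτ

/-- For a `(ν,μ)`-computable `f` from a Type 1 computable
topological space to the Lacombe topology of a Lacombe basis, `f` is effectively
continuous iff the preimage map on basic sets is `(β₂,τ₁)`-computable. -/
theorem effContinuous_iff_preimage_basic_lacombe {X Y : Type*}
    (ν : ℕ →. X) (μ : ℕ →. Y)
    (T₁ : TopologicalSpace X) (τ₁ : ℕ → Set X → Prop) (h₁ : IsCTSIncl ν T₁ τ₁)
    (β₂ : ℕ → Set Y → Prop) (h₂ : IsLacombeBasis μ β₂)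
    (f : X → Y) (hf : Computes ν μ f) :
    EffContinuous T₁ (TopologicalSpace.generateFrom {B | ∃ b, β₂ b B})
        τ₁ (LacombeName β₂) f ↔
      ∃ h : ℕ →. ℕ, Nat.Partrec h ∧ ∀ b B, β₂ b B → ∃ m ∈ h b, τ₁ m (f ⁻¹' B) := by
  constructor
  · rintro ⟨-, h, hh, hname⟩
    obtain ⟨s, hs, hW⟩ := exists_computable_W_eq_singleton
    exact ⟨fun b => h (s b), partrec_comp_computable hh hs, fun b B hB =>
      hname _ _ (lacombeName_of_W_eq_singleton h₂.single (hW b) hB)⟩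
  · rintro ⟨h, hh, hname⟩
    refine ⟨continuous_generateFrom_iff.2 ?_, ?_⟩
    · rintro B ⟨b, hB⟩
      obtain ⟨m, -, hm⟩ := hname b B hB
      exact h₁.isOpen m _ hm
    · obtain ⟨H, hH, hunion⟩ := h₁.exists_partrec_iUnion_W hh
      refine ⟨H, hH, ?_⟩
      rintro i O ⟨hdom, rfl⟩
      simp only [Set.preimage_iUnion]
      refine hunion i _ fun a ha => ?_
      obtain ⟨B, hB⟩ := hdom a ha
      have hEq : (⋃ B', ⋃ (_ : β₂ a B'), f ⁻¹' B') = f ⁻¹' B :=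
        Set.Subset.antisymm
          (Set.iUnion₂_subset fun B' hB' => (h₂.single _ _ _ hB' hB) ▸ subset_rfl)
          (Set.subset_iUnion₂_of_subset B hB subset_rfl)
      exact hEq ▸ hname a B hB

end T1
end

section
/- Let (X, ν, d) be a computable metric space*. Then the open balls of X centered at ν-computable points with computable radii, equipped with their natural numbering β(⟨n,m⟩) = B(ν(n), c_ℝ(m)) and with the natural formal inclusion relation ⟨n₁,m₁⟩ ⊆̊ ⟨n₂,m₂⟩ iff d(ν(n₁),ν(n₂)) + c_ℝ(m₁) ≤ c_ℝ(m₂), form a Spreen basis for (X, ν). -/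
namespace T1

theorem primrec_gcd : Primrec₂ Nat.gcd := by
  have h : Primrec fun p : ℕ × ℕ =>
      Nat.findGreatest (fun g => p.1 % g = 0 ∧ p.2 % g = 0) (p.1 + p.2) := by
    refine Primrec.nat_findGreatest (Primrec.nat_add.comp Primrec.fst Primrec.snd) ?_
    have h1 : PrimrecPred fun q : (ℕ × ℕ) × ℕ => q.1.1 % q.2 = 0 := Primrec.eq.comp
      (Primrec.nat_mod.comp (Primrec.fst.comp Primrec.fst) Primrec.snd) (Primrec.const 0)
    have h2 : PrimrecPred fun q : (ℕ × ℕ) × ℕ => q.1.2 % q.2 = 0 := Primrec.eq.comp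
      (Primrec.nat_mod.comp (Primrec.snd.comp Primrec.fst) Primrec.snd) (Primrec.const 0)
    exact (h1.and h2).primrecRel
  refine Primrec₂.mk (h.of_eq fun p => ?_)
  obtain ⟨a, b⟩ := p
  rw [Nat.findGreatest_eq_iff]
  refine ⟨?_, fun _ => ⟨Nat.mod_eq_zero_of_dvd (Nat.gcd_dvd_left a b),
    Nat.mod_eq_zero_of_dvd (Nat.gcd_dvd_right a b)⟩, ?_⟩
  · rcases Nat.eq_zero_or_pos a with rfl | ha
    · simp
    · exact (Nat.gcd_le_left b ha).trans (Nat.le_add_right _ _)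
  · rintro n hn hle ⟨h1, h2⟩
    have hd : n ∣ Nat.gcd a b :=
      Nat.dvd_gcd (Nat.dvd_of_mod_eq_zero h1) (Nat.dvd_of_mod_eq_zero h2)
    rcases Nat.eq_zero_or_pos (Nat.gcd a b) with h0 | h0
    · rw [Nat.gcd_eq_zero_iff] at h0
      dsimp only at hn hle h0
      omega
    · exact absurd (Nat.le_of_dvd h0 hd) (not_le.mpr hn)

theorem primrec_two_pow : Primrec fun n : ℕ => 2 ^ n :=
  (Primrec.nat_rec₁ 1 (f := fun _ a => 2 * a)
    (Primrec.nat_double.comp Primrec.snd).to₂).of_eq fun n => by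
      induction n with
      | zero => rfl
      | succ n ih => rw [pow_succ', ← ih]

/-- Validity of a code of a rational number. -/
def RatValid (k : ℕ) : Prop :=
  0 < k.unpair.2 ∧ Nat.gcd (k.unpair.1 / 2 + k.unpair.1 % 2) k.unpair.2 = 1

instance : DecidablePred RatValid := fun k => by unfold RatValid; infer_instance

/-- Positive part of the numerator of `ratOfNat k`. -/
def ratPos (k : ℕ) : ℕ := if RatValid k ∧ k.unpair.1 % 2 = 0 then k.unpair.1 / 2 else 0

/-- Negative part of the numerator of `ratOfNat k`. -/
def ratNeg (k : ℕ) : ℕ := if RatValid k ∧ k.unpair.1 % 2 = 1 then k.unpair.1 / 2 + 1 else 0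

/-- Denominator of `ratOfNat k`. -/
def ratDen (k : ℕ) : ℕ := if RatValid k then k.unpair.2 else 1

theorem ratDen_pos (k : ℕ) : 0 < ratDen k := by
  unfold ratDen
  split_ifs with h
  · exact h.1
  · exact one_pos

/-- The equivalence underlying the standard encoding of `ℚ`. -/
def ratEquivSigma : ℚ ≃ Σ n : ℤ, {d : ℕ // 0 < d ∧ n.natAbs.Coprime d} where
  toFun | ⟨a, b, c, d⟩ => ⟨a, b, Nat.pos_of_ne_zero c, d⟩
  invFun | ⟨a, b, c, d⟩ => ⟨a, b, Nat.pos_iff_ne_zero.mp c, d⟩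
  left_inv _ := rfl
  right_inv := fun ⟨_, _, _, _⟩ => rfl

theorem decode_rat (k : ℕ) : Encodable.decode (α := ℚ) k =
    (Encodable.decode (α := Σ n : ℤ, {d : ℕ // 0 < d ∧ n.natAbs.Coprime d}) k).map
      ratEquivSigma.symm :=
  Encodable.decode_ofEquiv ratEquivSigma k

theorem ratOfNat_eq (k : ℕ) :
    ratOfNat k = ((ratPos k : ℚ) - ratNeg k) / ratDen k := by
  obtain ⟨z, hz⟩ := Equiv.intEquivNat.surjective k.unpair.1
  have hdec : (Encodable.decode (α := ℤ) k.unpair.1) = some z := by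
    rw [← hz]; exact Encodable.encodek z
  have hA : z.natAbs = k.unpair.1 / 2 + k.unpair.1 % 2 := by
    rw [← hz]
    cases z with
    | ofNat m => change m = 2 * m / 2 + 2 * m % 2; omega
    | negSucc m => change m + 1 = (2 * m + 1) / 2 + (2 * m + 1) % 2; omega
  have hval : ratOfNat k = if RatValid k then (z : ℚ) / k.unpair.2 else 0 := by
    rw [ratOfNat, decode_rat, Encodable.decode_sigma_val, hdec]
    have hd : (Encodable.decode (α := {d : ℕ // 0 < d ∧ z.natAbs.Coprime d}) k.unpair.2) =
        if h : 0 < k.unpair.2 ∧ z.natAbs.Coprime k.unpair.2 then some ⟨_, h⟩ else none := rfl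
    simp only [Option.bind_some, hd]
    by_cases h : RatValid k
    · have h' : 0 < k.unpair.2 ∧ z.natAbs.Coprime k.unpair.2 := by
        rw [hA]; exact h
      rw [dif_pos h', if_pos h]
      obtain ⟨h₁, h₂⟩ := h'
      exact (Rat.num_div_den ⟨z, k.unpair.2, h₁.ne', h₂⟩).symm
    · have h' : ¬ (0 < k.unpair.2 ∧ z.natAbs.Coprime k.unpair.2) := by
        rw [hA]; exact h
      rw [dif_neg h', if_neg h]
      rfl
  rw [hval]
  unfold ratPos ratNeg ratDen
  by_cases h : RatValid k
  · simp only [h, true_and, if_true]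
    congr 1
    rw [← hz]
    cases z with
    | ofNat m =>
      change ((m : ℤ) : ℚ) = (if 2 * m % 2 = 0 then 2 * m / 2 else 0 : ℕ) -
        (if 2 * m % 2 = 1 then 2 * m / 2 + 1 else 0 : ℕ)
      simp
    | negSucc m =>
      change ((Int.negSucc m : ℤ) : ℚ) =
        (if (2 * m + 1) % 2 = 0 then (2 * m + 1) / 2 else 0 : ℕ) -
        (if (2 * m + 1) % 2 = 1 then (2 * m + 1) / 2 + 1 else 0 : ℕ)
      have h1 : (2 * m + 1) % 2 = 1 := by omega
      have h2 : (2 * m + 1) / 2 = m := by omega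
      simp [h1, h2, Int.negSucc_eq]
  · simp [h]

theorem ratOfNat_encode (q : ℚ) : ratOfNat (Encodable.encode q) = q := by
  simp [ratOfNat]

theorem primrecPred_ratValid : PrimrecPred RatValid := by
  have h1 : Primrec fun k : ℕ => k.unpair.1 := Primrec.fst.comp Primrec.unpair
  have h2 : Primrec fun k : ℕ => k.unpair.2 := Primrec.snd.comp Primrec.unpair
  refine PrimrecPred.and (Primrec.nat_lt.comp (Primrec.const 0) h2) (Primrec.eq.comp
    (primrec_gcd.comp (Primrec.nat_add.comp (Primrec.nat_div.comp h1 (Primrec.const 2))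
      (Primrec.nat_mod.comp h1 (Primrec.const 2))) h2) (Primrec.const 1))

theorem primrec_ratDen : Primrec ratDen :=
  Primrec.ite primrecPred_ratValid (Primrec.snd.comp Primrec.unpair) (Primrec.const 1)

theorem primrec_ratPos : Primrec ratPos := by
  have h1 : Primrec fun k : ℕ => k.unpair.1 := Primrec.fst.comp Primrec.unpair
  exact Primrec.ite (primrecPred_ratValid.and (Primrec.eq.comp
    (Primrec.nat_mod.comp h1 (Primrec.const 2)) (Primrec.const 0)))
    (Primrec.nat_div.comp h1 (Primrec.const 2)) (Primrec.const 0)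

theorem primrec_ratNeg : Primrec ratNeg := by
  have h1 : Primrec fun k : ℕ => k.unpair.1 := Primrec.fst.comp Primrec.unpair
  exact Primrec.ite (primrecPred_ratValid.and (Primrec.eq.comp
    (Primrec.nat_mod.comp h1 (Primrec.const 2)) (Primrec.const 1)))
    (Primrec.succ.comp (Primrec.nat_div.comp h1 (Primrec.const 2))) (Primrec.const 0)

theorem primrecRel_ratOfNat_le : PrimrecRel fun a b => ratOfNat a ≤ ratOfNat b := by
  have hP := primrec_ratPos
  have hN := primrec_ratNeg
  have hD := primrec_ratDen
  have h : PrimrecRel fun a b : ℕ => ratPos a * ratDen b + ratNeg b * ratDen a ≤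
      ratPos b * ratDen a + ratNeg a * ratDen b := by
    refine PrimrecPred.primrecRel (p := fun x : ℕ × ℕ =>
      ratPos x.1 * ratDen x.2 + ratNeg x.2 * ratDen x.1 ≤
        ratPos x.2 * ratDen x.1 + ratNeg x.1 * ratDen x.2) (Primrec.nat_le.comp
      (Primrec.nat_add.comp ?_ ?_) (Primrec.nat_add.comp ?_ ?_))
    · exact Primrec.nat_mul.comp (hP.comp Primrec.fst) (hD.comp Primrec.snd)
    · exact Primrec.nat_mul.comp (hN.comp Primrec.snd) (hD.comp Primrec.fst)
    · exact Primrec.nat_mul.comp (hP.comp Primrec.snd) (hD.comp Primrec.fst)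
    · exact Primrec.nat_mul.comp (hN.comp Primrec.fst) (hD.comp Primrec.snd)
  refine h.of_eq fun a b => ?_
  have ha : (0 : ℚ) < ratDen a := by exact_mod_cast ratDen_pos a
  have hb : (0 : ℚ) < ratDen b := by exact_mod_cast ratDen_pos b
  rw [ratOfNat_eq a, ratOfNat_eq b, div_le_div_iff₀ ha hb, ← Nat.cast_le (α := ℚ)]
  push_cast
  constructor <;> intro h <;> linarith

theorem exists_computable_ratOfNat_lt :
    ∃ lt : ℕ → ℕ → Bool, Computable₂ lt ∧ ∀ a b, lt a b = true ↔ ratOfNat a < ratOfNat b := by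
  obtain ⟨inst, h⟩ := primrecRel_ratOfNat_le
  refine ⟨fun a b => !@decide _ (inst (b, a)),
    (Primrec.not.comp (h.comp (Primrec.snd.pair Primrec.fst))).to_comp.to₂, fun a b => ?_⟩
  simp

/-- Fractions of computable natural numbers are computable as coded rationals. -/
theorem exists_computable_ratOfNat {α : Type*} [Primcodable α] {p n d : α → ℕ}
    (hp : Primrec p) (hn : Primrec n) (hd : Primrec d) (hpos : ∀ a, 0 < d a) :
    ∃ f : α → ℕ, Computable f ∧ ∀ a, ratOfNat (f a) = ((p a : ℚ) - n a) / d a := by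
  have hP := primrec_ratPos
  have hN := primrec_ratNeg
  have hD := primrec_ratDen
  let R : α → ℕ → Prop := fun a c =>
    ratPos c * d a + n a * ratDen c = p a * ratDen c + ratNeg c * d a
  have hR : ∀ a c, R a c ↔ ratOfNat c = ((p a : ℚ) - n a) / d a := by
    intro a c
    have ha : (0 : ℚ) < d a := by exact_mod_cast hpos a
    have hc : (0 : ℚ) < ratDen c := by exact_mod_cast ratDen_pos c
    rw [ratOfNat_eq c, div_eq_div_iff hc.ne' ha.ne']
    simp only [R]
    rw [← Nat.cast_inj (R := ℚ)]
    push_cast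
    constructor <;> intro h <;> linarith
  have hRp : PrimrecRel R := by
    refine PrimrecPred.primrecRel (p := fun x : α × ℕ =>
      ratPos x.2 * d x.1 + n x.1 * ratDen x.2 = p x.1 * ratDen x.2 + ratNeg x.2 * d x.1)
      (Primrec.eq.comp (Primrec.nat_add.comp ?_ ?_) (Primrec.nat_add.comp ?_ ?_))
    · exact Primrec.nat_mul.comp (hP.comp Primrec.snd) (hd.comp Primrec.fst)
    · exact Primrec.nat_mul.comp (hn.comp Primrec.fst) (hD.comp Primrec.snd)
    · exact Primrec.nat_mul.comp (hp.comp Primrec.fst) (hD.comp Primrec.snd)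
    · exact Primrec.nat_mul.comp (hN.comp Primrec.snd) (hd.comp Primrec.fst)
  have hex : ∀ a, ∃ c, R a c := fun a => ⟨_, (hR a _).2 (ratOfNat_encode _)⟩
  classical
  exact ⟨fun a => Nat.find (hex a), Computable.find (P := R) hRp.computablePred hex,
    fun a => (hR a _).1 (Nat.find_spec (hex a))⟩

theorem exists_computable_ratOfNat_sub :
    ∃ f : ℕ → ℕ → ℕ, Computable₂ f ∧ ∀ a b, ratOfNat (f a b) = ratOfNat a - ratOfNat b := by
  have hP := primrec_ratPos
  have hN := primrec_ratNeg
  have hD := primrec_ratDen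
  obtain ⟨f, hf, h⟩ := exists_computable_ratOfNat (α := ℕ × ℕ)
    (p := fun x => ratPos x.1 * ratDen x.2 + ratNeg x.2 * ratDen x.1)
    (n := fun x => ratNeg x.1 * ratDen x.2 + ratPos x.2 * ratDen x.1)
    (d := fun x => ratDen x.1 * ratDen x.2)
    (Primrec.nat_add.comp
      (Primrec.nat_mul.comp (hP.comp Primrec.fst) (hD.comp Primrec.snd))
      (Primrec.nat_mul.comp (hN.comp Primrec.snd) (hD.comp Primrec.fst)))
    (Primrec.nat_add.comp
      (Primrec.nat_mul.comp (hN.comp Primrec.fst) (hD.comp Primrec.snd))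
      (Primrec.nat_mul.comp (hP.comp Primrec.snd) (hD.comp Primrec.fst)))
    (Primrec.nat_mul.comp (hD.comp Primrec.fst) (hD.comp Primrec.snd))
    (fun x => Nat.mul_pos (ratDen_pos _) (ratDen_pos _))
  refine ⟨fun a b => f (a, b), hf.to₂, fun a b => ?_⟩
  have ha : (ratDen a : ℚ) ≠ 0 := by exact_mod_cast (ratDen_pos a).ne'
  have hb : (ratDen b : ℚ) ≠ 0 := by exact_mod_cast (ratDen_pos b).ne'
  rw [h, ratOfNat_eq a, ratOfNat_eq b]
  push_cast
  field_simp
  ring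

theorem exists_computable_ratOfNat_min :
    ∃ f : ℕ → ℕ → ℕ, Computable₂ f ∧
      ∀ a b, ratOfNat (f a b) = min (ratOfNat a) (ratOfNat b) := by
  refine ⟨fun a b => if ratOfNat a ≤ ratOfNat b then a else b,
    (Primrec.ite primrecRel_ratOfNat_le Primrec.fst Primrec.snd).to_comp.to₂, fun a b => ?_⟩
  rw [min_def]
  dsimp only
  split_ifs <;> rfl

theorem exists_computable_ratOfNat_two_div_pow :
    ∃ f : ℕ → ℕ, Computable f ∧ ∀ n, ratOfNat (f n) = 2 / 2 ^ n := by
  obtain ⟨f, hf, h⟩ := exists_computable_ratOfNat (Primrec.const 2) (Primrec.const 0)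
    primrec_two_pow (fun n => by positivity)
  exact ⟨f, hf, fun n => by rw [h]; simp⟩

theorem partrec_phi : Partrec₂ phi :=
  Nat.Partrec.Code.eval_part.comp ((Computable.ofNat _).comp Computable.fst) Computable.snd

/-- The parametrization theorem for `phi`. -/
theorem exists_phi_pair {f : ℕ →. ℕ} (hf : Partrec f) :
    ∃ s : ℕ → ℕ, Computable s ∧ ∀ t j, phi (s t) j = f (Nat.pair t j) := by
  obtain ⟨c, hc⟩ := Nat.Partrec.Code.exists_code.1 (Partrec.nat_iff.1 hf)
  refine ⟨fun t => Encodable.encode (c.curry t), Computable.encode.comp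
    (Nat.Partrec.Code.primrec₂_curry.comp (Primrec.const c) Primrec.id).to_comp, fun t j => ?_⟩
  rw [phi, Denumerable.ofNat_encode, Nat.Partrec.Code.eval_curry, hc]

theorem cRealName_iff {e : ℕ} {x : ℝ} :
    CRealName e x ↔ ∀ n, ∃ m ∈ phi e n, |(ratOfNat m : ℝ) - x| < ((2 : ℝ) ^ n)⁻¹ := by
  simp only [CRealName, zpow_neg, zpow_natCast]

theorem exists_two_pow_inv_lt {ε : ℝ} (hε : 0 < ε) : ∃ n : ℕ, ((2 : ℝ) ^ n)⁻¹ < ε := by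
  obtain ⟨n, hn⟩ := exists_pow_lt_of_lt_one hε (by norm_num : (2⁻¹ : ℝ) < 1)
  exact ⟨n, by rwa [inv_pow] at hn⟩

theorem CRealName.unique {e : ℕ} {x y : ℝ} (hx : CRealName e x) (hy : CRealName e y) :
    x = y := by
  by_contra hne
  rw [cRealName_iff] at hx hy
  obtain ⟨n, hn⟩ := exists_two_pow_inv_lt (half_pos (abs_sub_pos.2 hne))
  obtain ⟨m, hm, h1⟩ := hx n
  obtain ⟨m', hm', h2⟩ := hy n
  obtain rfl := Part.mem_unique hm hm'
  have h3 := abs_sub_le x (ratOfNat m : ℝ) y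
  rw [abs_sub_comm x (ratOfNat m : ℝ)] at h3
  linarith

/-- A Cauchy name of the rational number `q`. -/
def ratName (q : ℚ) : ℕ := Encodable.encode (Nat.Partrec.Code.const (Encodable.encode q))

theorem cRealName_ratName (q : ℚ) : CRealName (ratName q) (q : ℝ) := by
  rw [cRealName_iff]
  intro n
  refine ⟨Encodable.encode q, ?_, ?_⟩
  · rw [phi, ratName, Denumerable.ofNat_encode, Nat.Partrec.Code.eval_const]
    exact Part.mem_some _
  · rw [ratOfNat_encode, sub_self, abs_zero]
    positivity

/-- The real function `min (r₁ - d₁) (r₂ - d₂)` is computable on Cauchy names. -/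
theorem exists_computable_min_sub :
    ∃ M : (ℕ × ℕ) × (ℕ × ℕ) → ℕ, Computable M ∧ ∀ e₁ e₂ f₁ f₂ r₁ d₁ r₂ d₂,
      CRealName e₁ r₁ → CRealName f₁ d₁ → CRealName e₂ r₂ → CRealName f₂ d₂ →
        CRealName (M ((e₁, f₁), (e₂, f₂))) (min (r₁ - d₁) (r₂ - d₂)) := by
  obtain ⟨sub, hsub, sub_eq⟩ := exists_computable_ratOfNat_sub
  obtain ⟨mn, hmn, mn_eq⟩ := exists_computable_ratOfNat_min
  let D : (ℕ × ℕ) × ℕ →. ℕ := fun x =>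
    (phi x.1.1 x.2).bind fun a => (phi x.1.2 x.2).map fun b => sub a b
  have hD : Partrec D := by
    refine Partrec.bind (partrec_phi.comp (Computable.fst.comp Computable.fst) Computable.snd)
      (Partrec.map (partrec_phi.comp
        (Computable.snd.comp (Computable.fst.comp Computable.fst))
        (Computable.snd.comp Computable.fst)) ?_)
    exact hsub.comp (Computable.snd.comp Computable.fst) Computable.snd
  let G : ((ℕ × ℕ) × (ℕ × ℕ)) × ℕ →. ℕ := fun x =>
    (D (x.1.1, x.2 + 2)).bind fun a => (D (x.1.2, x.2 + 2)).map fun b => mn a b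
  have hj : Computable fun x : ((ℕ × ℕ) × (ℕ × ℕ)) × ℕ => x.2 + 2 :=
    Computable.succ.comp (Computable.succ.comp Computable.snd)
  have hG : Partrec G := by
    refine Partrec.bind (hD.comp ((Computable.fst.comp Computable.fst).pair hj))
      (Partrec.map (hD.comp ((Computable.snd.comp (Computable.fst.comp Computable.fst)).pair
        (hj.comp Computable.fst))) ?_)
    exact hmn.comp (Computable.snd.comp Computable.fst) Computable.snd
  let H : ℕ →. ℕ := fun n =>
    G (Denumerable.ofNat ((ℕ × ℕ) × (ℕ × ℕ)) n.unpair.1, n.unpair.2)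
  have hH : Partrec H := hG.comp
    (((Computable.ofNat _).comp (Computable.fst.comp Computable.unpair)).pair
      (Computable.snd.comp Computable.unpair))
  obtain ⟨s, hs, hphi⟩ := exists_phi_pair hH
  refine ⟨fun t => s (Encodable.encode t), hs.comp Computable.encode, ?_⟩
  intro e₁ e₂ f₁ f₂ r₁ d₁ r₂ d₂ hr₁ hd₁ hr₂ hd₂
  rw [cRealName_iff] at *
  intro j
  obtain ⟨a, ha, ha'⟩ := hr₁ (j + 2)
  obtain ⟨b, hb, hb'⟩ := hd₁ (j + 2)
  obtain ⟨c, hc, hc'⟩ := hr₂ (j + 2)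
  obtain ⟨d, hd, hd'⟩ := hd₂ (j + 2)
  refine ⟨mn (sub a b) (sub c d), ?_, ?_⟩
  · rw [hphi]
    simp only [H, Nat.unpair_pair, Denumerable.ofNat_encode, G]
    refine Part.mem_bind (Part.mem_bind ha (Part.mem_map _ hb))
      (Part.mem_map _ (Part.mem_bind hc (Part.mem_map _ hd)))
  · rw [mn_eq, sub_eq, sub_eq]
    push_cast
    have h4 : ((2 : ℝ) ^ (j + 2))⁻¹ = ((2 : ℝ) ^ j)⁻¹ / 4 := by
      rw [pow_add, mul_inv]; norm_num; ring
    have hpos : 0 < ((2 : ℝ) ^ j)⁻¹ := by positivity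
    rw [h4] at ha' hb' hc' hd'
    refine (abs_min_sub_min_le_max _ _ _ _).trans_lt (max_lt ?_ ?_)
    · rw [abs_lt] at *
      constructor <;> linarith
    · rw [abs_lt] at *
      constructor <;> linarith

/-- Strict inequality of computable reals is semi-decidable, uniformly in Cauchy names. -/
theorem exists_partrec_lt :
    ∃ L : ℕ × ℕ →. ℕ, Partrec L ∧ ∀ e f x y, CRealName e x → CRealName f y →
      ((L (e, f)).Dom ↔ x < y) := by
  obtain ⟨sub, hsub, sub_eq⟩ := exists_computable_ratOfNat_sub
  obtain ⟨lt, hlt, lt_iff⟩ := exists_computable_ratOfNat_lt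
  obtain ⟨pw, hpw, pw_eq⟩ := exists_computable_ratOfNat_two_div_pow
  let p : ℕ × ℕ → ℕ →. Bool := fun t j =>
    (phi t.1 j).bind fun a => (phi t.2 j).map fun c => lt (pw j) (sub c a)
  have hp : Partrec₂ p := by
    refine Partrec.bind (partrec_phi.comp (Computable.fst.comp Computable.fst) Computable.snd)
      (Partrec.map (partrec_phi.comp
        (Computable.snd.comp (Computable.fst.comp Computable.fst))
        (Computable.snd.comp Computable.fst)) ?_)
    exact hlt.comp (hpw.comp (Computable.snd.comp (Computable.fst.comp Computable.fst)))
      (hsub.comp Computable.snd (Computable.snd.comp Computable.fst))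
  refine ⟨fun t => Nat.rfind (p t), Partrec.rfind hp, fun e f x y he hf => ?_⟩
  rw [cRealName_iff] at he hf
  have hmem : ∀ {j a c}, a ∈ phi e j → c ∈ phi f j →
      lt (pw j) (sub c a) ∈ p (e, f) j :=
    fun ha hc => Part.mem_bind ha (Part.mem_map _ hc)
  have hcond : ∀ j a c, lt (pw j) (sub c a) = true ↔
      2 * ((2 : ℝ) ^ j)⁻¹ < (ratOfNat c : ℝ) - ratOfNat a := by
    intro j a c
    rw [lt_iff, sub_eq, pw_eq, ← Rat.cast_lt (K := ℝ)]
    push_cast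
    rw [div_eq_mul_inv]
  change (Nat.rfind (p (e, f))).Dom ↔ x < y
  rw [Nat.rfind_dom']
  constructor
  · rintro ⟨j, hj, -⟩
    obtain ⟨a, ha, ha'⟩ := he j
    obtain ⟨c, hc, hc'⟩ := hf j
    have h := Part.mem_unique hj (hmem ha hc)
    have h' := (hcond j a c).1 h.symm
    rw [abs_lt] at ha' hc'
    linarith
  · intro hxy
    obtain ⟨j, hj⟩ := exists_two_pow_inv_lt (show 0 < (y - x) / 4 by linarith)
    refine ⟨j, ?_, fun {m} _ => ?_⟩
    · obtain ⟨a, ha, ha'⟩ := he j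
      obtain ⟨c, hc, hc'⟩ := hf j
      have h' : lt (pw j) (sub c a) = true := by
        rw [hcond]
        rw [abs_lt] at ha' hc'
        linarith
      exact h' ▸ hmem ha hc
    · obtain ⟨a, ha, -⟩ := he m
      obtain ⟨c, hc, -⟩ := hf m
      exact Part.dom_iff_mem.2 ⟨_, hmem ha hc⟩

section Balls

variable {X : Type*} [MetricSpace X] {ν : ℕ →. X}

theorem ballName_unique {b : ℕ} {B B' : Set X} (h : ballName ν b B) (h' : ballName ν b B') :
    B = B' := by
  obtain ⟨x, r, hx, hr, rfl⟩ := h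
  obtain ⟨y, s, hy, hs, rfl⟩ := h'
  rw [Part.mem_unique hx hy, hr.unique hs]

theorem isFormalIncl_ballIncl : IsFormalIncl (ballName ν) (ballIncl ν) where
  refl := by
    rintro n A ⟨x, r, hx, hr, -⟩
    exact ⟨x, x, r, r, hx, hx, hr, hr, by simp⟩
  trans := by
    rintro a b c ⟨x, y, r, s, hx, hy, hr, hs, h⟩ ⟨y', z, s', t, hy', hz, hs', ht, h'⟩
    obtain rfl := Part.mem_unique hy hy'
    obtain rfl := hs.unique hs'
    refine ⟨x, z, r, t, hx, hz, hr, ht, ?_⟩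
    linarith [dist_triangle x y z]
  mono := by
    rintro n m A B ⟨x, y, r, s, hx, hy, hr, hs, h⟩ ⟨x', r', hx', hr', rfl⟩
      ⟨y', s', hy', hs', rfl⟩
    rw [Part.mem_unique hx' hx, Part.mem_unique hy' hy, hr'.unique hr, hs'.unique hs]
    exact Metric.ball_subset_ball' (by linarith)

theorem exists_partrec_semiDecName_ball (hcms : IsCMS ν) :
    ∃ F : ℕ →. ℕ, Nat.Partrec F ∧ ∀ b B, ballName ν b B → ∃ e ∈ F b, SemiDecName ν B e := by
  obtain ⟨F, hF, hdist⟩ := hcms.dist_comp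
  obtain ⟨L, hL, hlt⟩ := exists_partrec_lt
  have hunp1 : Computable fun n : ℕ => n.unpair.1 := Computable.fst.comp Computable.unpair
  have hunp2 : Computable fun n : ℕ => n.unpair.2 := Computable.snd.comp Computable.unpair
  let G : ℕ →. ℕ := fun n =>
    (F (Nat.pair n.unpair.2 n.unpair.1.unpair.1)).bind fun e => L (e, n.unpair.1.unpair.2)
  have hG : Partrec G := by
    refine Partrec.bind ((Partrec.nat_iff.2 hF).comp
      (Primrec₂.natPair.to_comp.comp hunp2 (hunp1.comp hunp1))) ?_
    exact hL.comp (Computable.snd.pair (hunp2.comp (hunp1.comp Computable.fst)))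
  obtain ⟨s, hs, hphi⟩ := exists_phi_pair hG
  refine ⟨fun b => Part.some (s b), Partrec.nat_iff.1 hs.partrec, ?_⟩
  rintro b B ⟨c, r, hc, hr, rfl⟩
  refine ⟨s b, Part.mem_some _, fun i x hx => ?_⟩
  obtain ⟨e, he, hname⟩ := hdist _ _ _ _ hx hc
  rw [hphi]
  simp only [G, Nat.unpair_pair]
  rw [Part.eq_some_iff.2 he, Part.bind_some, hlt _ _ _ _ hname hr, Metric.mem_ball]

theorem IsCMS.exists_dist_lt (hcms : IsCMS ν) (x : X) {δ : ℝ} (hδ : 0 < δ) :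
    ∃ n y, y ∈ ν n ∧ dist x y < δ := by
  obtain ⟨y, ⟨n, hn⟩, hy⟩ := hcms.dense.exists_dist_lt x hδ
  exact ⟨n, y, hn, hy⟩

theorem ballName_pair {n m : ℕ} {x : X} {r : ℝ} (hx : x ∈ ν n) (hr : CRealName m r) :
    ballName ν (Nat.pair n m) (Metric.ball x r) :=
  ⟨x, r, by rwa [Nat.unpair_pair], by rwa [Nat.unpair_pair], rfl⟩

theorem ballIncl_pair {n m n' m' : ℕ} {x y : X} {r s : ℝ} (hx : x ∈ ν n) (hy : y ∈ ν n')
    (hr : CRealName m r) (hs : CRealName m' s) (h : dist x y + r ≤ s) :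
    ballIncl ν (Nat.pair n m) (Nat.pair n' m') :=
  ⟨x, y, r, s, by rwa [Nat.unpair_pair], by rwa [Nat.unpair_pair], by rwa [Nat.unpair_pair],
    by rwa [Nat.unpair_pair], h⟩

/-- From a point and two names of balls one computes the name of a ball centered at this point,
whose radius is the smallest of the two differences between the radius of the ball and the
distance of the point to its center. -/
theorem exists_partrec_inter_ball (hcms : IsCMS ν) :
    ∃ g : ℕ →. ℕ, Nat.Partrec g ∧ ∀ n b₁ b₂ k x c₁ c₂ r₁ r₂, x ∈ ν n →
      c₁ ∈ ν b₁.unpair.1 → c₂ ∈ ν b₂.unpair.1 →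
      CRealName b₁.unpair.2 r₁ → CRealName b₂.unpair.2 r₂ →
      ∃ e, g (Nat.pair (Nat.pair n (Nat.pair b₁ b₂)) k) = Part.some (Nat.pair n e) ∧
        CRealName e (min (r₁ - dist x c₁) (r₂ - dist x c₂)) := by
  obtain ⟨F, hF, hdist⟩ := hcms.dist_comp
  obtain ⟨M, hM, hmin⟩ := exists_computable_min_sub
  have hunp1 : Computable fun n : ℕ => n.unpair.1 := Computable.fst.comp Computable.unpair
  have hunp2 : Computable fun n : ℕ => n.unpair.2 := Computable.snd.comp Computable.unpair
  let G : ℕ × (ℕ × ℕ) →. ℕ := fun t =>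
    (F (Nat.pair t.1 t.2.1.unpair.1)).bind fun f₁ =>
      (F (Nat.pair t.1 t.2.2.unpair.1)).map fun f₂ =>
        Nat.pair t.1 (M ((t.2.1.unpair.2, f₁), (t.2.2.unpair.2, f₂)))
  have hb₁ : Computable fun t : ℕ × (ℕ × ℕ) => t.2.1 := Computable.fst.comp Computable.snd
  have hb₂ : Computable fun t : ℕ × (ℕ × ℕ) => t.2.2 := Computable.snd.comp Computable.snd
  have hG : Partrec G := by
    refine Partrec.bind ((Partrec.nat_iff.2 hF).comp
      (Primrec₂.natPair.to_comp.comp Computable.fst (hunp1.comp hb₁)))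
      (Partrec.map ((Partrec.nat_iff.2 hF).comp (Primrec₂.natPair.to_comp.comp
        (Computable.fst.comp Computable.fst) (hunp1.comp (hb₂.comp Computable.fst)))) ?_)
    refine Primrec₂.natPair.to_comp.comp
      (Computable.fst.comp (Computable.fst.comp Computable.fst)) (hM.comp ?_)
    exact ((hunp2.comp (hb₁.comp (Computable.fst.comp Computable.fst))).pair
      (Computable.snd.comp Computable.fst)).pair
      ((hunp2.comp (hb₂.comp (Computable.fst.comp Computable.fst))).pair Computable.snd)
  let H : ℕ →. ℕ := fun p =>
    G (p.unpair.1.unpair.1, (p.unpair.1.unpair.2.unpair.1, p.unpair.1.unpair.2.unpair.2))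
  have hH : Partrec H := hG.comp ((hunp1.comp hunp1).pair
    ((hunp1.comp (hunp2.comp hunp1)).pair (hunp2.comp (hunp2.comp hunp1))))
  refine ⟨H, Partrec.nat_iff.1 hH, ?_⟩
  intro n b₁ b₂ k x c₁ c₂ r₁ r₂ hx hc₁ hc₂ hr₁ hr₂
  obtain ⟨f₁, hf₁, hd₁⟩ := hdist _ _ _ _ hx hc₁
  obtain ⟨f₂, hf₂, hd₂⟩ := hdist _ _ _ _ hx hc₂
  refine ⟨M ((b₁.unpair.2, f₁), (b₂.unpair.2, f₂)), ?_, hmin _ _ _ _ _ _ _ _ hr₁ hd₁ hr₂ hd₂⟩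
  simp only [H, G, Nat.unpair_pair]
  rw [Part.eq_some_iff.2 hf₁, Part.bind_some, Part.eq_some_iff.2 hf₂, Part.map_some]

end Balls

/-- In any computable metric space* `(X, ν, d)`, the open balls
centered at computable points with computable radii, with their natural numbering
`β⟨n,m⟩ = B(ν n, c_ℝ m)` and the natural formal inclusion relation
`⟨n₁,m₁⟩ ⊆̊ ⟨n₂,m₂⟩ ↔ d(ν n₁, ν n₂) + c_ℝ m₁ ≤ c_ℝ m₂`, form a Spreen basis. -/
theorem balls_isSpreenBasis {X : Type*} [MetricSpace X] (ν : ℕ →. X)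
    (hcms : IsCMS ν) :
    IsSpreenBasis ν (ballName ν) (ballIncl ν) := by
  refine ⟨fun _ _ _ h h' => ballName_unique h h', isFormalIncl_ballIncl,
    exists_partrec_semiDecName_ball hcms, ?_, ?_, ?_⟩
  · rintro b B ⟨c, r, -, -, rfl⟩ hne
    obtain ⟨x, hx, n, hn⟩ := hcms.dense.inter_open_nonempty _ Metric.isOpen_ball hne
    exact ⟨n, x, hn, hx⟩
  · have hone : CRealName (ratName 1) 1 := by simpa using cRealName_ratName 1
    refine ⟨fun p => Part.some (Nat.pair p.unpair.1 (ratName 1)), Partrec.nat_iff.1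
      (Primrec₂.natPair.to_comp.comp (Computable.fst.comp Computable.unpair)
        (Computable.const _)).partrec, ?_, ?_, ?_⟩
    · intro n x hx
      exact ⟨fun _ => Nat.pair n (ratName 1), fun k => by simp,
        fun _ => ⟨_, ballName_pair hx hone, by simp⟩⟩
    · intro n m x s t hn hm hs ht
      simp only [Nat.unpair_pair, Part.mem_some_iff] at hs ht
      refine ⟨fun p => ⟨0, ?_⟩, fun p => ⟨0, ?_⟩⟩
      · rw [hs, ht]
        exact ballIncl_pair hn hm hone hone (by simp)
      · rw [hs, ht]
        exact ballIncl_pair hm hn hone hone (by simp)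
    · intro x
      obtain ⟨n, y, hn, hy⟩ := hcms.exists_dist_lt x (show (0 : ℝ) < (1 / 2 : ℚ) by norm_num)
      refine ⟨_, _, ballName_pair hn (cRealName_ratName (1 / 2)), hy, ?_⟩
      intro m z hm hz s hs
      simp only [Nat.unpair_pair, Part.mem_some_iff] at hs
      refine ⟨0, ?_⟩
      rw [hs]
      refine ballIncl_pair hn hm (cRealName_ratName _) hone ?_
      rw [Metric.mem_ball, dist_comm] at hz
      push_cast at hz ⊢
      linarith
  · obtain ⟨g, hg, hgs⟩ := exists_partrec_inter_ball hcms
    refine ⟨g, hg, ?_, ?_, ?_⟩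
    · rintro n x b₁ b₂ _ _ hx ⟨c₁, r₁, hc₁, hr₁, rfl⟩ ⟨c₂, r₂, hc₂, hr₂, rfl⟩ hx₁ hx₂
      rw [Metric.mem_ball] at hx₁ hx₂
      choose e he hname using fun k => hgs n b₁ b₂ k x c₁ c₂ r₁ r₂ hx hc₁ hc₂ hr₁ hr₂
      refine ⟨fun k => Nat.pair n (e k), fun k => by rw [he]; exact Part.mem_some _,
        fun k => ⟨_, ballName_pair hx (hname k), ?_, ?_⟩⟩
      · exact Metric.mem_ball_self (lt_min (by linarith) (by linarith))
      · refine Set.subset_inter (Metric.ball_subset_ball' ?_) (Metric.ball_subset_ball' ?_)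
        · linarith [min_le_left (r₁ - dist x c₁) (r₂ - dist x c₂)]
        · linarith [min_le_right (r₁ - dist x c₁) (r₂ - dist x c₂)]
    · rintro n m x b₁ b₂ b₁' b₂' s t hn hm
        ⟨c₁, c₁', r₁, r₁', hc₁, hc₁', hr₁, hr₁', h₁⟩ ⟨c₂, c₂', r₂, r₂', hc₂, hc₂', hr₂, hr₂', h₂⟩
        hs ht p
      refine ⟨0, ?_⟩
      obtain ⟨e, he, hname⟩ := hgs n b₁ b₂ p x c₁ c₂ r₁ r₂ hn hc₁ hc₂ hr₁ hr₂
      obtain ⟨e', he', hname'⟩ := hgs m b₁' b₂' 0 x c₁' c₂' r₁' r₂' hm hc₁' hc₂' hr₁' hr₂'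
      have hsp := hs p
      have ht0 := ht 0
      rw [he, Part.mem_some_iff] at hsp
      rw [he', Part.mem_some_iff] at ht0
      rw [hsp, ht0]
      refine ballIncl_pair hn hm hname hname' ?_
      rw [dist_self, zero_add]
      refine min_le_min ?_ ?_
      · linarith [dist_triangle x c₁ c₁']
      · linarith [dist_triangle x c₂ c₂']
    · rintro b₁ b₂ _ _ ⟨c₁, r₁, hc₁, hr₁, rfl⟩ ⟨c₂, r₂, hc₂, hr₂, rfl⟩ x hx₁ hx₂
      rw [Metric.mem_ball] at hx₁ hx₂
      have hpos : 0 < min (r₁ - dist x c₁) (r₂ - dist x c₂) / 4 := by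
        have := lt_min (sub_pos.2 hx₁) (sub_pos.2 hx₂)
        positivity
      obtain ⟨δ, hδ, hδ'⟩ := exists_rat_btwn hpos
      obtain ⟨n, y, hn, hy⟩ := hcms.exists_dist_lt x hδ
      refine ⟨_, _, ballName_pair hn (cRealName_ratName δ), hy, ?_⟩
      intro m z hm hz s hs
      refine ⟨0, ?_⟩
      obtain ⟨e, he, hname⟩ := hgs m b₁ b₂ 0 z c₁ c₂ r₁ r₂ hm hc₁ hc₂ hr₁ hr₂
      have hs0 := hs 0
      rw [he, Part.mem_some_iff] at hs0
      rw [hs0]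
      refine ballIncl_pair hn hm (cRealName_ratName δ) hname ?_
      rw [Metric.mem_ball] at hz
      have hzx : dist z x ≤ dist z y + dist x y := dist_triangle_right z x y
      rw [dist_comm y z]
      refine le_min ?_ ?_
      · linarith [dist_triangle z x c₁, min_le_left (r₁ - dist x c₁) (r₂ - dist x c₂)]
      · linarith [dist_triangle z x c₂, min_le_right (r₁ - dist x c₁) (r₂ - dist x c₂)]

end T1
end
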